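/- Let m ≥ 0 and β > 0, and let ω_p = √(‖p‖² + m²). Define 𝒯 = {z ∈ ℂ⁴ : Im z₀ > ‖Im z⃗‖ and β − Im z₀ > ‖Im z⃗‖}, where z = (z₀, z⃗) and Im z⃗ = (Im z₁, Im z₂, Im z₃). Then for every z ∈ 𝒯 the integral F(z) = (2π)⁻³ ∫_{ℝ³} (2ω_p)⁻¹ (1 − e^{−βω_p})⁻¹ ( e^{i(ω_p z₀ − ⟨p, z⃗⟩)} + e^{−i(ω_p z₀ − ⟨p, z⃗⟩)} e^{−βω_p} ) dp converges absolutely, and F is holomorphic on the open set 𝒯 ⊂ ℂ⁴. (This establishes the relativistic KMS condition of Bros–Buchholz for the thermal two-point function of the free field: holomorphy in the tube 𝒯_{βe} = {z : Im z ∈ V₊ ∩ (βe + V₋)} with e = (1,0,0,0).) -/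

import Mathlib

open MeasureTheory Real Complex

/-- Relativistic energy ω_p = √(‖p‖² + m²). -/
noncomputable def omega (m : ℝ) (p : EuclideanSpace ℝ (Fin 3)) : ℝ :=
  Real.sqrt (‖p‖ ^ 2 + m ^ 2)

/-- The tube 𝒯_{βe} = {z ∈ ℂ⁴ : Im z ∈ V₊ ∩ (βe + V₋)}, e = (1,0,0,0):
    Im z₀ > ‖Im z⃗‖ and β − Im z₀ > ‖Im z⃗‖. -/
noncomputable def relTube (β : ℝ) : Set (Fin 4 → ℂ) :=
  {z | Real.sqrt ((z 1).im ^ 2 + (z 2).im ^ 2 + (z 3).im ^ 2) < (z 0).im ∧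
       Real.sqrt ((z 1).im ^ 2 + (z 2).im ^ 2 + (z 3).im ^ 2) < β - (z 0).im}

/-- ⟨p, z⃗⟩ = p₁z₁ + p₂z₂ + p₃z₃ ∈ ℂ for p ∈ ℝ³ and z ∈ ℂ⁴. -/
noncomputable def pairSpatial (p : EuclideanSpace ℝ (Fin 3)) (z : Fin 4 → ℂ) : ℂ :=
  (p 0 : ℂ) * z 1 + (p 1 : ℂ) * z 2 + (p 2 : ℂ) * z 3

/-- The momentum-space integrand of the thermal two-point function at
    complex spacetime argument z ∈ ℂ⁴. -/
noncomputable def relIntegrand (m β : ℝ) (z : Fin 4 → ℂ)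
    (p : EuclideanSpace ℝ (Fin 3)) : ℂ :=
  (((2 * omega m p)⁻¹ * (1 - Real.exp (-β * omega m p))⁻¹ : ℝ) : ℂ) *
    (Complex.exp (Complex.I * ((omega m p : ℂ) * z 0 - pairSpatial p z)) +
      Complex.exp (-(Complex.I * ((omega m p : ℂ) * z 0 - pairSpatial p z))) *
        (Real.exp (-β * omega m p) : ℂ))

/-- F(z) = (2π)⁻³ ∫_{ℝ³} relIntegrand dp, analytic continuation of the thermal
    two-point function to the relativistic KMS tube. -/
noncomputable def relThermalF (m β : ℝ) (z : Fin 4 → ℂ) : ℂ :=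
  (((2 * Real.pi) ^ 3)⁻¹ : ℝ) •
    ∫ p : EuclideanSpace ℝ (Fin 3), relIntegrand m β z p

/-- The complex-linear form `z ↦ ω_p z₀ - ⟨p, z⃗⟩`. -/
noncomputable def phaseForm (m : ℝ) (p : EuclideanSpace ℝ (Fin 3)) : (Fin 4 → ℂ) →L[ℂ] ℂ :=
  (omega m p : ℂ) • ContinuousLinearMap.proj 0 - ((p 0 : ℂ) • ContinuousLinearMap.proj 1 +
    (p 1 : ℂ) • ContinuousLinearMap.proj 2 + (p 2 : ℂ) • ContinuousLinearMap.proj 3)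

/-- The thermal weight `(2ω_p)⁻¹ (1 - e^{-βω_p})⁻¹`. -/
noncomputable def thermalWeight (m β : ℝ) (p : EuclideanSpace ℝ (Fin 3)) : ℝ :=
  (2 * omega m p)⁻¹ * (1 - Real.exp (-β * omega m p))⁻¹

/-- The Fréchet derivative of `relIntegrand` in the spacetime argument. -/
noncomputable def relIntegrandDeriv (m β : ℝ) (z : Fin 4 → ℂ)
    (p : EuclideanSpace ℝ (Fin 3)) : (Fin 4 → ℂ) →L[ℂ] ℂ :=
  ((thermalWeight m β p : ℂ) * (Complex.I * (Complex.exp (Complex.I * phaseForm m p z) -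
    Complex.exp (-(Complex.I * phaseForm m p z)) * (Real.exp (-β * omega m p) : ℂ)))) •
      phaseForm m p

/-- The Euclidean norm of the spatial imaginary part. -/
noncomputable def spatialIm (z : Fin 4 → ℂ) : ℝ :=
  Real.sqrt ((z 1).im ^ 2 + (z 2).im ^ 2 + (z 3).im ^ 2)

lemma continuous_spatialIm : Continuous spatialIm := by
  unfold spatialIm
  fun_prop

lemma phaseForm_apply (m : ℝ) (p : EuclideanSpace ℝ (Fin 3)) (z : Fin 4 → ℂ) :
    phaseForm m p z = (omega m p : ℂ) * z 0 - pairSpatial p z := by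
  simp [phaseForm, pairSpatial]

lemma continuous_omega (m : ℝ) : Continuous (omega m) := by
  unfold omega
  fun_prop

lemma continuous_phaseForm (m : ℝ) : Continuous (phaseForm m) := by
  have := continuous_omega m
  unfold phaseForm
  fun_prop

lemma measurable_thermalWeight (m β : ℝ) : Measurable (thermalWeight m β) := by
  have := (continuous_omega m).measurable
  unfold thermalWeight
  fun_prop

lemma relIntegrand_eq (m β : ℝ) (z : Fin 4 → ℂ) (p : EuclideanSpace ℝ (Fin 3)) :
    relIntegrand m β z p = (thermalWeight m β p : ℂ) *
      (Complex.exp (Complex.I * phaseForm m p z) +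
        Complex.exp (-(Complex.I * phaseForm m p z)) * (Real.exp (-β * omega m p) : ℂ)) := by
  rw [phaseForm_apply]
  rfl

lemma norm_le_omega (m : ℝ) (p : EuclideanSpace ℝ (Fin 3)) : ‖p‖ ≤ omega m p :=
  Real.le_sqrt_of_sq_le (by nlinarith [sq_nonneg m])

lemma omega_nonneg (m : ℝ) (p : EuclideanSpace ℝ (Fin 3)) : 0 ≤ omega m p :=
  Real.sqrt_nonneg _

lemma norm_phaseForm_le (m : ℝ) (p : EuclideanSpace ℝ (Fin 3)) :
    ‖phaseForm m p‖ ≤ 4 * omega m p := by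
  have hω := omega_nonneg m p
  refine ContinuousLinearMap.opNorm_le_bound _ (by positivity) fun z => ?_
  have hz (i : Fin 4) : ‖z i‖ ≤ ‖z‖ := norm_le_pi_norm z i
  have hp (i : Fin 3) : ‖(p i : ℂ)‖ ≤ omega m p := by
    rw [Complex.norm_real]
    exact (PiLp.norm_apply_le p i).trans (norm_le_omega m p)
  have key (i : Fin 3) (j : Fin 4) : ‖(p i : ℂ) * z j‖ ≤ omega m p * ‖z‖ := by
    rw [norm_mul]
    exact mul_le_mul (hp i) (hz j) (norm_nonneg _) hω
  have key₀ : ‖(omega m p : ℂ) * z 0‖ ≤ omega m p * ‖z‖ := by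
    rw [norm_mul, Complex.norm_real, Real.norm_of_nonneg hω]
    exact mul_le_mul_of_nonneg_left (hz 0) hω
  rw [phaseForm_apply, pairSpatial]
  have h₁ := norm_sub_le ((omega m p : ℂ) * z 0)
    ((p 0 : ℂ) * z 1 + (p 1 : ℂ) * z 2 + (p 2 : ℂ) * z 3)
  have h₂ := norm_add₃_le (a := (p 0 : ℂ) * z 1) (b := (p 1 : ℂ) * z 2) (c := (p 2 : ℂ) * z 3)
  linarith [key 0 1, key 1 2, key 2 3]

lemma abs_im_pairSpatial_le (m : ℝ) (p : EuclideanSpace ℝ (Fin 3)) (z : Fin 4 → ℂ) :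
    |(pairSpatial p z).im| ≤ omega m p * spatialIm z := by
  have him : (pairSpatial p z).im = p 0 * (z 1).im + p 1 * (z 2).im + p 2 * (z 3).im := by
    simp [pairSpatial]
  have hn : ‖p‖ ^ 2 = p 0 ^ 2 + p 1 ^ 2 + p 2 ^ 2 := by
    rw [EuclideanSpace.real_norm_sq_eq, Fin.sum_univ_three]
  have hs : 0 ≤ spatialIm z := Real.sqrt_nonneg _
  refine le_trans (abs_le_of_sq_le_sq ?_ (by positivity))
    (mul_le_mul_of_nonneg_right (norm_le_omega m p) hs)
  rw [mul_pow, hn, him, spatialIm, Real.sq_sqrt (by positivity)]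
  nlinarith [sq_nonneg (p 0 * (z 2).im - p 1 * (z 1).im),
    sq_nonneg (p 0 * (z 3).im - p 2 * (z 1).im), sq_nonneg (p 1 * (z 3).im - p 2 * (z 2).im)]

lemma im_phaseForm (m : ℝ) (p : EuclideanSpace ℝ (Fin 3)) (z : Fin 4 → ℂ) :
    (phaseForm m p z).im = omega m p * (z 0).im - (pairSpatial p z).im := by
  simp [phaseForm_apply]

lemma norm_exp_phaseForm_le {m δ : ℝ} {z : Fin 4 → ℂ} (p : EuclideanSpace ℝ (Fin 3))
    (hδ : 0 ≤ δ) (h : δ + spatialIm z ≤ (z 0).im) :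
    ‖Complex.exp (Complex.I * phaseForm m p z)‖ ≤ Real.exp (-δ * ‖p‖) := by
  rw [Complex.norm_exp, Real.exp_le_exp, Complex.I_mul_re, im_phaseForm]
  have h₁ := abs_le.1 (abs_im_pairSpatial_le m p z)
  have h₂ := mul_le_mul_of_nonneg_left h (omega_nonneg m p)
  have h₃ := mul_le_mul_of_nonneg_left (norm_le_omega m p) hδ
  linarith

lemma norm_exp_neg_phaseForm_le {m β δ : ℝ} {z : Fin 4 → ℂ} (p : EuclideanSpace ℝ (Fin 3))
    (hδ : 0 ≤ δ) (h : δ + spatialIm z ≤ β - (z 0).im) :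
    ‖Complex.exp (-(Complex.I * phaseForm m p z)) * (Real.exp (-β * omega m p) : ℂ)‖ ≤
      Real.exp (-δ * ‖p‖) := by
  rw [norm_mul, Complex.norm_exp, Complex.norm_real, Real.norm_of_nonneg (Real.exp_nonneg _),
    ← Real.exp_add, Real.exp_le_exp, Complex.neg_re, Complex.I_mul_re, im_phaseForm]
  have h₁ := abs_le.1 (abs_im_pairSpatial_le m p z)
  have h₂ := mul_le_mul_of_nonneg_left h (omega_nonneg m p)
  have h₃ := mul_le_mul_of_nonneg_left (norm_le_omega m p) hδ
  linarith

lemma inv_one_sub_exp_neg_le {x : ℝ} (hx : 0 < x) : (1 - Real.exp (-x))⁻¹ ≤ 1 + x⁻¹ := by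
  have h₁ : 1 + x ≤ Real.exp x := by linarith [Real.add_one_le_exp x]
  have h₂ : Real.exp (-x) ≤ (1 + x)⁻¹ := by
    rw [Real.exp_neg]
    exact inv_anti₀ (by positivity) h₁
  have h₃ : 1 - (1 + x)⁻¹ = (1 + x⁻¹)⁻¹ := by
    field_simp
    ring
  exact inv_le_of_inv_le₀ (by positivity) (by linarith)

lemma thermalWeight_bounds {β : ℝ} (m : ℝ) (hβ : 0 < β) {p : EuclideanSpace ℝ (Fin 3)}
    (hp : p ≠ 0) :
    0 ≤ thermalWeight m β p ∧
    thermalWeight m β p ≤ (1 + β⁻¹) * (1 + (‖p‖ ^ 2)⁻¹) ∧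
    thermalWeight m β p * omega m p ≤ (1 + β⁻¹) * (1 + (‖p‖ ^ 2)⁻¹) := by
  have hp' : 0 < ‖p‖ := norm_pos_iff.2 hp
  have hle := norm_le_omega m p
  have hω : 0 < omega m p := hp'.trans_le hle
  have h₁ : (1 - Real.exp (-β * omega m p))⁻¹ ≤ 1 + β⁻¹ * (omega m p)⁻¹ := by
    rw [neg_mul, ← mul_inv]
    exact inv_one_sub_exp_neg_le (by positivity)
  have h₂ : 0 ≤ (1 - Real.exp (-β * omega m p))⁻¹ := by
    rw [inv_nonneg, sub_nonneg, Real.exp_le_one_iff]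
    nlinarith
  have h₃ : ((omega m p)⁻¹) ^ 2 ≤ (‖p‖ ^ 2)⁻¹ := by
    rw [inv_pow]
    exact inv_anti₀ (by positivity) (by gcongr)
  have hmul : thermalWeight m β p * omega m p = 2⁻¹ * (1 - Real.exp (-β * omega m p))⁻¹ := by
    unfold thermalWeight
    field_simp
  have heq : thermalWeight m β p = 2⁻¹ * (omega m p)⁻¹ * (1 - Real.exp (-β * omega m p))⁻¹ := by
    rw [thermalWeight, mul_inv]
  have hb : 0 < β⁻¹ := inv_pos.2 hβ
  have ht : 0 < (omega m p)⁻¹ := inv_pos.2 hω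
  rw [hmul, heq]
  set t := (omega m p)⁻¹
  have ht₂ : t ≤ 1 + t ^ 2 := by nlinarith [sq_nonneg (t - 1)]
  have hmono : (1 + β⁻¹) * (1 + t ^ 2) ≤ (1 + β⁻¹) * (1 + (‖p‖ ^ 2)⁻¹) := by gcongr
  refine ⟨by positivity, le_trans ?_ hmono, le_trans ?_ hmono⟩
  · have := mul_le_mul_of_nonneg_left h₁ ht.le
    nlinarith [mul_nonneg hb.le (sq_nonneg t)]
  · have := mul_le_mul_of_nonneg_left ht₂ hb.le
    nlinarith [mul_nonneg hb.le (sq_nonneg t), sq_nonneg t]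

lemma integrable_one_add_inv_sq_mul_exp {δ : ℝ} (hδ : 0 < δ) :
    Integrable fun p : EuclideanSpace ℝ (Fin 3) =>
      (1 + (‖p‖ ^ 2)⁻¹) * Real.exp (-δ * ‖p‖) := by
  rw [integrable_fun_norm_addHaar (μ := (volume : Measure (EuclideanSpace ℝ (Fin 3))))
    (f := fun y : ℝ => (1 + (y ^ 2)⁻¹) * Real.exp (-δ * y))]
  have h (s : ℝ) (hs : -1 < s) :
      IntegrableOn (fun y : ℝ => y ^ s * Real.exp (-δ * y)) (Set.Ioi 0) := by
    simpa using integrableOn_rpow_mul_exp_neg_mul_rpow hs one_pos hδ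
  refine ((h 2 (by norm_num)).add (h 0 (by norm_num))).congr_fun (fun y hy => ?_)
    measurableSet_Ioi
  have hy' : y ≠ 0 := (Set.mem_Ioi.1 hy).ne'
  simp
  field_simp

/-- The points of the tube at distance at least `δ` from both boundary cones in the time
direction. -/
def innerTube (β δ : ℝ) : Set (Fin 4 → ℂ) :=
  {z | δ + spatialIm z < (z 0).im ∧ δ + spatialIm z < β - (z 0).im}

lemma isOpen_innerTube (β δ : ℝ) : IsOpen (innerTube β δ) := by
  have := continuous_spatialIm
  unfold innerTube
  rw [Set.ofPred_and]
  refine (isOpen_lt ?_ ?_).inter (isOpen_lt ?_ ?_) <;> fun_prop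

lemma relTube_eq_innerTube_zero (β : ℝ) : relTube β = innerTube β 0 := by
  simp [relTube, innerTube, spatialIm]

lemma exists_mem_innerTube {β : ℝ} {z : Fin 4 → ℂ} (hz : z ∈ relTube β) :
    ∃ δ > 0, z ∈ innerTube β δ := by
  obtain ⟨h₁, h₂⟩ := hz
  obtain ⟨δ, hδ, h⟩ := exists_between (lt_min (sub_pos.2 h₁) (sub_pos.2 h₂))
  obtain ⟨h₃, h₄⟩ := lt_min_iff.1 h
  exact ⟨δ, hδ, lt_sub_iff_add_lt.1 h₃, lt_sub_iff_add_lt.1 h₄⟩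

lemma norm_relIntegrand_le {m β δ : ℝ} (hβ : 0 < β) (hδ : 0 < δ) {z : Fin 4 → ℂ}
    (hz : z ∈ innerTube β δ) {p : EuclideanSpace ℝ (Fin 3)} (hp : p ≠ 0) :
    ‖relIntegrand m β z p‖ ≤
      2 * (1 + β⁻¹) * ((1 + (‖p‖ ^ 2)⁻¹) * Real.exp (-δ * ‖p‖)) := by
  obtain ⟨h₀, h₁, -⟩ := thermalWeight_bounds m hβ hp
  rw [relIntegrand_eq, norm_mul, Complex.norm_real, Real.norm_of_nonneg h₀]
  calc _ ≤ ((1 + β⁻¹) * (1 + (‖p‖ ^ 2)⁻¹)) *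
        (Real.exp (-δ * ‖p‖) + Real.exp (-δ * ‖p‖)) :=
        mul_le_mul h₁ (norm_add_le_of_le (norm_exp_phaseForm_le p hδ.le hz.1.le)
          (norm_exp_neg_phaseForm_le p hδ.le hz.2.le)) (norm_nonneg _) (h₀.trans h₁)
    _ = _ := by ring

lemma norm_relIntegrandDeriv_le {m β δ : ℝ} (hβ : 0 < β) (hδ : 0 < δ) {z : Fin 4 → ℂ}
    (hz : z ∈ innerTube β δ) {p : EuclideanSpace ℝ (Fin 3)} (hp : p ≠ 0) :
    ‖relIntegrandDeriv m β z p‖ ≤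
      8 * (1 + β⁻¹) * ((1 + (‖p‖ ^ 2)⁻¹) * Real.exp (-δ * ‖p‖)) := by
  obtain ⟨h₀, -, h₁⟩ := thermalWeight_bounds m hβ hp
  have hω := omega_nonneg m p
  rw [relIntegrandDeriv, norm_smul, norm_mul, norm_mul, Complex.norm_I, one_mul,
    Complex.norm_real, Real.norm_of_nonneg h₀]
  calc _ ≤ (thermalWeight m β p * (Real.exp (-δ * ‖p‖) + Real.exp (-δ * ‖p‖))) *
        (4 * omega m p) := by
        refine mul_le_mul (mul_le_mul_of_nonneg_left ?_ h₀) (norm_phaseForm_le m p)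
          (norm_nonneg _) (by positivity)
        exact norm_sub_le_of_le (norm_exp_phaseForm_le p hδ.le hz.1.le)
          (norm_exp_neg_phaseForm_le p hδ.le hz.2.le)
    _ = 8 * (thermalWeight m β p * omega m p) * Real.exp (-δ * ‖p‖) := by ring
    _ ≤ 8 * ((1 + β⁻¹) * (1 + (‖p‖ ^ 2)⁻¹)) * Real.exp (-δ * ‖p‖) := by gcongr
    _ = _ := by ring

lemma measurable_relIntegrand (m β : ℝ) (z : Fin 4 → ℂ) : Measurable (relIntegrand m β z) := by
  have h₁ := measurable_thermalWeight m β
  have h₂ := (continuous_omega m).measurable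
  have h₃ : Measurable fun p => phaseForm m p z :=
    ((continuous_phaseForm m).clm_apply continuous_const).measurable
  rw [funext (relIntegrand_eq m β z)]
  fun_prop

lemma aestronglyMeasurable_relIntegrandDeriv (m β : ℝ) (z : Fin 4 → ℂ) :
    AEStronglyMeasurable (relIntegrandDeriv m β z) := by
  have h₁ := measurable_thermalWeight m β
  have h₂ := (continuous_omega m).measurable
  have h₃ : Measurable fun p => phaseForm m p z :=
    ((continuous_phaseForm m).clm_apply continuous_const).measurable
  have h₄ : Measurable fun p => (thermalWeight m β p : ℂ) *
      (Complex.I * (Complex.exp (Complex.I * phaseForm m p z) -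
        Complex.exp (-(Complex.I * phaseForm m p z)) * (Real.exp (-β * omega m p) : ℂ))) := by
    fun_prop
  exact h₄.aestronglyMeasurable.smul (continuous_phaseForm m).aestronglyMeasurable

lemma ae_ne_zero : ∀ᵐ p : EuclideanSpace ℝ (Fin 3), p ≠ 0 :=
  Measure.ae_ne volume 0

lemma integrable_relIntegrand (m : ℝ) {β : ℝ} (hβ : 0 < β) {z : Fin 4 → ℂ}
    (hz : z ∈ relTube β) : Integrable (relIntegrand m β z) := by
  obtain ⟨δ, hδ, hzδ⟩ := exists_mem_innerTube hz
  refine ((integrable_one_add_inv_sq_mul_exp hδ).const_mul (2 * (1 + β⁻¹))).mono'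
    (measurable_relIntegrand m β z).aestronglyMeasurable ?_
  filter_upwards [ae_ne_zero] with p hp
  exact norm_relIntegrand_le hβ hδ hzδ hp

lemma hasFDerivAt_relIntegrand (m β : ℝ) (z : Fin 4 → ℂ) (p : EuclideanSpace ℝ (Fin 3)) :
    HasFDerivAt (fun w => relIntegrand m β w p) (relIntegrandDeriv m β z p) z := by
  simp_rw [relIntegrand_eq]
  have h := (phaseForm m p).hasFDerivAt (x := z) |>.const_mul Complex.I
  refine ((h.cexp.add (h.neg.cexp.mul_const
    (Real.exp (-β * omega m p) : ℂ))).const_mul (thermalWeight m β p : ℂ)).congr_fderiv ?_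
  rw [relIntegrandDeriv, Pi.neg_apply]
  module

lemma differentiableAt_integral_relIntegrand (m : ℝ) {β : ℝ} (hβ : 0 < β) {z : Fin 4 → ℂ}
    (hz : z ∈ relTube β) :
    DifferentiableAt ℂ (fun w => ∫ p, relIntegrand m β w p) z := by
  obtain ⟨δ, hδ, hzδ⟩ := exists_mem_innerTube hz
  refine (hasFDerivAt_integral_of_dominated_of_fderiv_le
    (F' := relIntegrandDeriv m β)
    (bound := fun p => 8 * (1 + β⁻¹) * ((1 + (‖p‖ ^ 2)⁻¹) * Real.exp (-δ * ‖p‖)))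
    ((isOpen_innerTube β δ).mem_nhds hzδ)
    (.of_forall fun w => (measurable_relIntegrand m β w).aestronglyMeasurable)
    (integrable_relIntegrand m hβ hz) (aestronglyMeasurable_relIntegrandDeriv m β z) ?_
    ((integrable_one_add_inv_sq_mul_exp hδ).const_mul _)
    (.of_forall fun p w _ => hasFDerivAt_relIntegrand m β w p)).differentiableAt
  filter_upwards [ae_ne_zero] with p hp w hw
  exact norm_relIntegrandDeriv_le hβ hδ hw hp

/-- Relativistic KMS condition of Bros–Buchholz for the thermal two-point
    function of the free field: on the open tube 𝒯 the defining integral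
    converges absolutely and F is holomorphic. -/
theorem relativistic_KMS_holomorphy (m β : ℝ) (hm : 0 ≤ m) (hβ : 0 < β) :
    IsOpen (relTube β) ∧
    (∀ z ∈ relTube β, Integrable (relIntegrand m β z)) ∧
    DifferentiableOn ℂ (relThermalF m β) (relTube β) := by
  refine ⟨relTube_eq_innerTube_zero β ▸ isOpen_innerTube β 0,
    fun z hz => integrable_relIntegrand m hβ hz, fun z hz => ?_⟩
  exact ((differentiableAt_integral_relIntegrand m hβ hz).const_smul
    (((2 * Real.pi) ^ 3)⁻¹ : ℝ)).differentiableWithinAt
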